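/- Let n ≥ 2 and let M₁ and M₂ be centered star bodies in ℝⁿ such that λ_{n−1}(M₁ ∩ u^⊥) = λ_{n−1}(M₂ ∩ u^⊥) for every u ∈ S^{n−1}. Then M₁ = M₂. (Equivalently: for every star body L that is an intersection body, the centered star body M with L = IM is unique.) -/

import Mathlib

open MeasureTheory Metric
open scoped RealInnerProductSpace ENNReal

noncomputable section

abbrev E (n : ℕ) := EuclideanSpace ℝ (Fin n)

/-- The radial function of a set: `ρ_K(x) = max {c ≥ 0 : c • x ∈ K}`. -/
def radialFn {n : ℕ} (K : Set (E n)) (x : E n) : ℝ :=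
  sSup {c : ℝ | 0 ≤ c ∧ c • x ∈ K}

/-- A convex body: compact convex set with nonempty interior. -/
def IsConvexBody {n : ℕ} (K : Set (E n)) : Prop :=
  IsCompact K ∧ Convex ℝ K ∧ (interior K).Nonempty

/-- Centered: symmetric about the origin. -/
def IsCentered {n : ℕ} (K : Set (E n)) : Prop :=
  ∀ x, x ∈ K ↔ -x ∈ K

/-- The hyperplane through the origin orthogonal to `u`. -/
def hyperplane {n : ℕ} (u : E n) : Set (E n) := {x | ⟪x, u⟫ = 0}

/-- A star body: compact, star-shaped at the origin (contains the origin), with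
continuous radial function on the unit sphere. -/
def IsStarBody {n : ℕ} (L : Set (E n)) : Prop :=
  IsCompact L ∧ (0 : E n) ∈ L ∧ StarConvex ℝ 0 L ∧
    ContinuousOn (radialFn L) (sphere (0 : E n) 1)

/-- `L` is the intersection body of `M`: `ρ_L(u) = λ_{n-1}(M ∩ u^⊥)` for `u ∈ S^{n-1}`. -/
def IsIntersectionBodyOf {n : ℕ} (L M : Set (E n)) : Prop :=
  ∀ u ∈ sphere (0 : E n) 1,
    radialFn L u = (μH[(n : ℝ) - 1] (M ∩ hyperplane u)).toReal

/-- The spherical Radon transform: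
`(Rg)(u) = ∫_{S^{n-1} ∩ u^⊥} g dλ_{n-2}`. -/
def radon (n : ℕ) (g : E n → ℝ) (u : E n) : ℝ :=
  ∫ v in (sphere (0 : E n) 1 ∩ hyperplane u), g v ∂μH[(n : ℝ) - 2]

/-- A function on the sphere is C^∞ if its 0-homogeneous extension is smooth
away from the origin. -/
def SmoothOnSphere {n : ℕ} (h : E n → ℝ) : Prop :=
  ContDiffOn ℝ (⊤ : ℕ∞) (fun x : E n => h (‖x‖⁻¹ • x)) {(0 : E n)}ᶜ

/-- A body of revolution about the axis `u₀`: invariant under every (linear)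
isometry of `ℝⁿ` fixing `u₀`. -/
def IsRevolutionBody {n : ℕ} (u₀ : E n) (K : Set (E n)) : Prop :=
  ∀ f : E n ≃ₗᵢ[ℝ] E n, f u₀ = u₀ → f '' K = K

/-- A family `rot` of linear isometries, indexed by a measure space, whose averages behave like
averages over the orthogonal group. -/
structure IsRotationAverage {V G : Type*} [NormedAddCommGroup V] [InnerProductSpace ℝ V]
    [TopologicalSpace G] [MeasurableSpace G] (μ : Measure G) (rot : G → V ≃ₗᵢ[ℝ] V) : Prop where
  continuous_rot : Continuous fun p : G × V => rot p.1 p.2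
  exists_rot_eq : ∀ ⦃x y : V⦄, ‖x‖ = ‖y‖ → ∃ g, rot g x = y
  integral_rot_comp : ∀ (T : V ≃ₗᵢ[ℝ] V) (Φ : V → V → ℝ) (x y : V),
    ∫ g, Φ (rot g (T x)) (rot g (T y)) ∂μ = ∫ g, Φ (rot g x) (rot g y) ∂μ

theorem IsRotationAverage.continuous_rot_apply {V G : Type*} [NormedAddCommGroup V]
    [InnerProductSpace ℝ V] [TopologicalSpace G] [MeasurableSpace G] {μ : Measure G}
    {rot : G → V ≃ₗᵢ[ℝ] V} (h : IsRotationAverage μ rot) (x : V) :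
    Continuous fun g => rot g x :=
  h.continuous_rot.comp (continuous_id.prodMk continuous_const)

theorem exists_linearIsometryEquiv_eq {V : Type*} [NormedAddCommGroup V] [InnerProductSpace ℝ V]
    {x y : V} (h : ‖x‖ = ‖y‖) : ∃ T : V ≃ₗᵢ[ℝ] V, T x = y ∧ T y = x := by
  refine ⟨(Submodule.span ℝ {x - y})ᗮ.reflection, Submodule.reflection_sub h, ?_⟩
  have := congrArg (Submodule.span ℝ {x - y})ᗮ.reflection (Submodule.reflection_sub h)
  rw [Submodule.reflection_reflection] at this
  exact this.symm

/-- The Haar measure on the orthogonal group yields a rotation average. -/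
theorem exists_isRotationAverage.{u} (V : Type u) [NormedAddCommGroup V] [InnerProductSpace ℝ V]
    [FiniteDimensional ℝ V] :
    ∃ (G : Type u) (_ : TopologicalSpace G) (_ : CompactSpace G) (_ : MeasurableSpace G)
      (_ : BorelSpace G) (μ : Measure G) (_ : IsFiniteMeasure μ) (_ : μ.IsOpenPosMeasure)
      (rot : G → V ≃ₗᵢ[ℝ] V), IsRotationAverage μ rot := by
  have : CompleteSpace V := FiniteDimensional.complete ℝ V
  have : ContinuousStar (V →L[ℝ] V) :=
    ⟨(ContinuousLinearMap.adjoint (𝕜 := ℝ) (E := V) (F := V)).continuous⟩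
  have hcomp : CompactSpace (unitary (V →L[ℝ] V)) := by
    refine isCompact_iff_compactSpace.1 (isCompact_of_isClosed_isBounded
      (s := (unitary (V →L[ℝ] V) : Set (V →L[ℝ] V))) isClosed_unitary ?_)
    refine isBounded_iff_forall_norm_le.2 ⟨1, fun U hU => ?_⟩
    refine ContinuousLinearMap.opNorm_le_bound _ zero_le_one fun x => ?_
    rw [one_mul]
    exact (Unitary.norm_map ⟨U, hU⟩ x).le
  let _ : MeasurableSpace (unitary (V →L[ℝ] V)) := borel _
  have : BorelSpace (unitary (V →L[ℝ] V)) := ⟨rfl⟩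
  refine ⟨unitary (V →L[ℝ] V), inferInstance, hcomp, inferInstance, inferInstance, Measure.haar,
    inferInstance, inferInstance, fun g => Unitary.linearIsometryEquiv g⁻¹, ⟨?_, ?_, ?_⟩⟩
  · have h : Continuous fun g : unitary (V →L[ℝ] V) => (Subtype.val g⁻¹ : V →L[ℝ] V) :=
      continuous_subtype_val.comp continuous_inv
    exact (h.comp continuous_fst).clm_apply continuous_snd
  · intro x y hxy
    obtain ⟨T, hT, -⟩ := exists_linearIsometryEquiv_eq hxy
    exact ⟨(Unitary.linearIsometryEquiv.symm T)⁻¹, by simp [hT]⟩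
  · intro T Φ x y
    rw [← integral_mul_left_eq_self (fun g : unitary (V →L[ℝ] V) =>
      Φ (Unitary.linearIsometryEquiv g⁻¹ x) (Unitary.linearIsometryEquiv g⁻¹ y))
      (Unitary.linearIsometryEquiv.symm T)⁻¹]
    simp

/-- A continuous function on a compact space is integrable. -/
theorem integrable_of_compactSpace {X : Type*} [TopologicalSpace X] [CompactSpace X]
    [MeasurableSpace X] [OpensMeasurableSpace X] {μ : Measure X} [IsFiniteMeasureOnCompacts μ]
    {f : X → ℝ} (hf : Continuous f) : Integrable f μ :=
  hf.integrable_of_hasCompactSupport (.of_compactSpace f)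

/-- A continuous function `f ∘ w` that is orthogonal to all functions `exp ⟪v, w ·⟫` vanishes. -/
theorem eq_zero_of_integral_mul_exp {n : ℕ} {X : Type*} [TopologicalSpace X] [CompactSpace X]
    [MeasurableSpace X] [OpensMeasurableSpace X] {μ : Measure X} [IsFiniteMeasureOnCompacts μ]
    [μ.IsOpenPosMeasure] {w : X → E n} (hw : Continuous w) {f : E n → ℝ} (hf : Continuous f)
    (h : ∀ v : E n, ∫ x, f (w x) * Real.exp ⟪v, w x⟫ ∂μ = 0) (x : X) : f (w x) = 0 := by
  let e : E n → C(E n, ℝ) := fun v => ⟨fun y => Real.exp ⟪v, y⟫, by fun_prop⟩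
  let A : Subalgebra ℝ C(E n, ℝ) := Algebra.adjoin ℝ (Set.range e)
  have hA : A.SeparatesPoints := by
    intro y z hyz
    refine ⟨e (y - z), ⟨e (y - z), Algebra.subset_adjoin ⟨_, rfl⟩, rfl⟩, fun hex => hyz ?_⟩
    have : ⟪y - z, y⟫ = ⟪y - z, z⟫ := Real.exp_injective hex
    rwa [← sub_eq_zero, ← inner_sub_right, inner_self_eq_zero, sub_eq_zero] at this
  have hclosure : ∀ p ∈ Submonoid.closure (Set.range e), p ∈ Set.range e := by
    intro p hp
    induction hp using Submonoid.closure_induction with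
    | mem p hp => exact hp
    | one => exact ⟨0, by ext; simp [e]⟩
    | mul p q _ _ hp hq =>
      obtain ⟨v, rfl⟩ := hp
      obtain ⟨u, rfl⟩ := hq
      exact ⟨v + u, by ext; simp [e, inner_add_left, Real.exp_add]⟩
  have hint : ∀ p : C(E n, ℝ), Integrable (fun x => f (w x) * p (w x)) μ := fun p =>
    integrable_of_compactSpace (by fun_prop)
  have horth : ∀ p ∈ A, ∫ x, f (w x) * p (w x) ∂μ = 0 := by
    intro p hp
    rw [← Subalgebra.mem_toSubmodule, Algebra.adjoin_eq_span] at hp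
    induction hp using Submodule.span_induction with
    | mem p hp =>
      obtain ⟨v, rfl⟩ := hclosure p hp
      exact h v
    | zero => simp
    | add p q _ _ hp hq =>
      simp only [ContinuousMap.add_apply, mul_add]
      rw [integral_add (hint p) (hint q), hp, hq, add_zero]
    | smul c p _ hp =>
      simp only [ContinuousMap.smul_apply, smul_eq_mul, mul_left_comm _ c]
      rw [integral_const_mul, hp, mul_zero]
  have hfw : Continuous fun x => f (w x) := hf.comp hw
  have hle : ∀ ε > 0, ∫ x, f (w x) * f (w x) ∂μ ≤ ε * ∫ x, |f (w x)| ∂μ := by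
    intro ε hε
    obtain ⟨p, hp, hpε⟩ :=
      ContinuousMap.exists_mem_subalgebra_near_continuous_of_isCompact_of_separatesPoints hA
        ⟨f, hf⟩ (isCompact_range hw) hε
    calc ∫ x, f (w x) * f (w x) ∂μ
        = ∫ x, f (w x) * f (w x) ∂μ - ∫ x, f (w x) * p (w x) ∂μ := by rw [horth p hp, sub_zero]
      _ = ∫ x, (f (w x) * f (w x) - f (w x) * p (w x)) ∂μ :=
          (integral_sub (hint ⟨f, hf⟩) (hint p)).symm
      _ ≤ ∫ x, ε * |f (w x)| ∂μ := by
          refine integral_mono ((hint ⟨f, hf⟩).sub (hint p))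
            (integrable_of_compactSpace (by fun_prop)) fun x => ?_
          have := hpε (w x) ⟨x, rfl⟩
          rw [Real.norm_eq_abs, abs_sub_comm] at this
          calc f (w x) * f (w x) - f (w x) * p (w x) = f (w x) * (f (w x) - p (w x)) := by ring
            _ ≤ |f (w x) * (f (w x) - p (w x))| := le_abs_self _
            _ = |f (w x) - p (w x)| * |f (w x)| := by rw [abs_mul, mul_comm]
            _ ≤ ε * |f (w x)| := by gcongr; exact this.le
      _ = ε * ∫ x, |f (w x)| ∂μ := integral_const_mul _ _
  by_contra hx
  have hpos : 0 < ∫ x, f (w x) * f (w x) ∂μ :=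
    (hfw.mul hfw).integral_pos_of_hasCompactSupport_nonneg_nonzero (.of_compactSpace _)
      (fun x => mul_self_nonneg _) (mul_self_ne_zero.2 hx)
  set I := ∫ x, f (w x) * f (w x) ∂μ
  set J := ∫ x, |f (w x)| ∂μ
  have hJ : 0 ≤ J := integral_nonneg fun x => abs_nonneg _
  have := hle (I / (2 * (J + 1))) (by positivity)
  rw [div_mul_eq_mul_div, le_div_iff₀ (by positivity)] at this
  nlinarith

/-- Vanishing of all moments implies orthogonality to exponentials. -/
theorem integral_mul_exp_eq_zero {X : Type*} [TopologicalSpace X] [CompactSpace X]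
    [MeasurableSpace X] [OpensMeasurableSpace X] {μ : Measure X} [IsFiniteMeasure μ]
    {f s : X → ℝ} (hf : Continuous f) (hs : Continuous s)
    (h : ∀ k : ℕ, ∫ x, f x * s x ^ k ∂μ = 0) : ∫ x, f x * Real.exp (s x) ∂μ = 0 := by
  obtain ⟨C, hC⟩ := isCompact_univ.exists_bound_of_continuousOn hf.continuousOn
  obtain ⟨D, hD⟩ := isCompact_univ.exists_bound_of_continuousOn hs.continuousOn
  have hsum := hasSum_integral_of_summable_integral_norm (μ := μ)
    (F := fun (k : ℕ) x => f x * (s x ^ k / k.factorial))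
    (fun k => integrable_of_compactSpace (by fun_prop)) ?_
  · have h1 : ∀ k : ℕ, ∫ x, f x * (s x ^ k / k.factorial) ∂μ = 0 := by
      intro k
      simp only [← mul_div_assoc]
      rw [integral_div, h k, zero_div]
    simp only [h1] at hsum
    have h2 := hsum.unique hasSum_zero
    rw [← h2]
    congr 1 with x
    rw [tsum_mul_left, Real.exp_eq_exp_ℝ, NormedSpace.exp_eq_tsum_div]
  · refine Summable.of_nonneg_of_le (fun k => integral_nonneg fun x => norm_nonneg _)
      (fun k => ?_) (((Real.summable_pow_div_factorial D).mul_left C).mul_right (μ.real Set.univ))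
    refine (Real.le_norm_self _).trans (norm_integral_le_of_norm_le_const (.of_forall fun x => ?_))
    rw [norm_norm, norm_mul, norm_div, norm_pow, RCLike.norm_natCast]
    have hCx := hC x trivial
    have hDx := hD x trivial
    have := (norm_nonneg _).trans hCx
    gcongr
open scoped Pointwise in
/-- The surface measure on the unit sphere is invariant under linear isometries. -/
theorem integral_toSphere_comp {d : ℕ} (T : E d ≃ₗᵢ[ℝ] E d) {φ : E d → ℝ} (hφ : Continuous φ) :
    ∫ θ : sphere (0 : E d) 1, φ (T θ) ∂(volume : Measure (E d)).toSphere =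
      ∫ θ : sphere (0 : E d) 1, φ θ ∂(volume : Measure (E d)).toSphere := by
  let S : sphere (0 : E d) 1 → sphere (0 : E d) 1 := fun θ => ⟨T θ, by simp⟩
  have hS : Continuous S := by fun_prop
  have hmap : (volume : Measure (E d)).toSphere.map S = (volume : Measure (E d)).toSphere := by
    ext s hs
    rw [Measure.map_apply hS.measurable hs, Measure.toSphere_apply' _ hs,
      Measure.toSphere_apply' _ (hS.measurable hs),
      ← T.measurePreserving.measure_preimage_emb T.toHomeomorph.measurableEmbedding
        (Set.Ioo (0 : ℝ) 1 • (Subtype.val '' s))]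
    congr 2
    ext x
    simp only [Set.mem_smul, Set.mem_image, Set.mem_preimage]
    constructor
    · rintro ⟨t, ht, _, ⟨θ, hθ, rfl⟩, rfl⟩
      exact ⟨t, ht, _, ⟨S θ, hθ, rfl⟩, by simp [S]⟩
    · rintro ⟨t, ht, _, ⟨θ, hθ, rfl⟩, h⟩
      refine ⟨t, ht, T.symm θ, ⟨⟨T.symm θ, by simp⟩, by simpa [S] using hθ, rfl⟩, ?_⟩
      apply T.injective
      rw [← h]
      simp
  conv_rhs => rw [← hmap]
  rw [integral_map hS.aemeasurable (by fun_prop)]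

theorem exists_sphere_moment {d : ℕ} (hd : d ≠ 0) (k : ℕ) :
    ∃ c : ℝ, 0 < c ∧ ∀ a : E d, ∫ θ : sphere (0 : E d) 1, ⟪(θ : E d), a⟫ ^ (2 * k)
      ∂(volume : Measure (E d)).toSphere = c * (‖a‖ ^ 2) ^ k := by
  have : NeZero d := ⟨hd⟩
  obtain ⟨a₀, ha₀⟩ := exists_norm_eq (E d) zero_le_one
  refine ⟨∫ θ : sphere (0 : E d) 1, ⟪(θ : E d), a₀⟫ ^ (2 * k)
      ∂(volume : Measure (E d)).toSphere, ?_, fun a => ?_⟩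
  · refine Continuous.integral_pos_of_hasCompactSupport_nonneg_nonzero
      (x := ⟨a₀, by simpa using ha₀⟩) (by fun_prop) (.of_compactSpace _) (fun θ => ?_) ?_
    · rw [pow_mul]
      exact pow_nonneg (sq_nonneg _) _
    · simp [ha₀]
  · obtain ⟨T, hT, -⟩ := exists_linearIsometryEquiv_eq (x := ‖a‖ • a₀) (y := a)
      (by simp [norm_smul, ha₀])
    rw [← integral_toSphere_comp T (φ := fun θ => ⟪θ, a⟫ ^ (2 * k)) (by fun_prop),
      ← integral_mul_const]
    congr 1 with θ
    conv_lhs => rw [← hT]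
    rw [LinearIsometryEquiv.inner_map_map, inner_smul_right, mul_pow, pow_mul ‖a‖, mul_comm]

theorem volumeIoiPow_le (m : ℕ) {c : ℝ} (hc : 0 ≤ c) :
    Measure.volumeIoiPow m {t : Set.Ioi (0 : ℝ) | (t : ℝ) ≤ c} =
      ENNReal.ofReal (c ^ (m + 1) / (m + 1)) := by
  have him : Subtype.val '' {t : Set.Ioi (0 : ℝ) | (t : ℝ) ≤ c} = Set.Ioc 0 c := by
    ext t
    simp [and_comm]
  have hmeas : MeasurableSet {t : Set.Ioi (0 : ℝ) | (t : ℝ) ≤ c} :=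
    measurableSet_le measurable_subtype_coe measurable_const
  rw [Measure.volumeIoiPow, withDensity_apply _ hmeas,
    setLIntegral_subtype measurableSet_Ioi _ fun a : ℝ => .ofReal (a ^ m), him,
    ← ofReal_integral_eq_lintegral_ofReal (intervalIntegral.intervalIntegrable_pow _).1,
    ← intervalIntegral.integral_of_le hc]
  · simp
  · filter_upwards [ae_restrict_mem measurableSet_Ioc] with y hy
    exact pow_nonneg hy.1.le _

/-- The volume of a star-shaped set in polar coordinates. -/
theorem volume_eq_of_radial {d : ℕ} (hd : d ≠ 0) {K : Set (E d)} {r : E d → ℝ}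
    (hr : Continuous fun θ : sphere (0 : E d) 1 => r θ) (hr0 : ∀ θ ∈ sphere (0 : E d) 1, 0 ≤ r θ)
    (hK : ∀ θ ∈ sphere (0 : E d) 1, ∀ t : ℝ, 0 < t → (t • θ ∈ K ↔ t ≤ r θ)) :
    volume K = ENNReal.ofReal
      ((∫ θ : sphere (0 : E d) 1, r θ ^ d ∂(volume : Measure (E d)).toSphere) / d) := by
  have : NeZero d := ⟨hd⟩
  have hmp := (volume : Measure (E d)).measurePreserving_homeomorphUnitSphereProd
  let S : Set (sphere (0 : E d) 1 × Set.Ioi (0 : ℝ)) := {p | (p.2 : ℝ) ≤ r p.1}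
  have hS : MeasurableSet S := measurableSet_le (by fun_prop)
    (hr.measurable.comp measurable_fst)
  have hpre : homeomorphUnitSphereProd (E d) ⁻¹' S = Subtype.val ⁻¹' K := by
    ext x
    have hx : 0 < ‖(x : E d)‖ := norm_pos_iff.2 x.2
    have := hK (‖(x : E d)‖⁻¹ • (x : E d)) (by simp [norm_smul, hx.ne']) ‖(x : E d)‖ hx
    rw [smul_inv_smul₀ hx.ne'] at this
    simp [S, this]
  have h1 : volume K = (Measure.comap (Subtype.val : ({0}ᶜ : Set (E d)) → E d) volume)
      (Subtype.val ⁻¹' K) := by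
    rw [comap_subtype_coe_apply (measurableSet_singleton _).compl, Subtype.image_preimage_coe,
      Set.inter_comm, ← Set.sdiff_eq, measure_sdiff_null (measure_singleton _)]
  obtain ⟨m, rfl⟩ := Nat.exists_eq_succ_of_ne_zero hd
  rw [h1, ← hpre, hmp.measure_preimage_emb (Homeomorph.measurableEmbedding _),
    Measure.prod_apply hS, ← integral_div, ofReal_integral_eq_lintegral_ofReal]
  · congr 1 with θ
    have := volumeIoiPow_le m (hr0 θ θ.2)
    simp only [finrank_euclideanSpace, Fintype.card_fin, Nat.succ_eq_add_one, Nat.add_sub_cancel]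
    push_cast
    exact this
  · exact integrable_of_compactSpace ((hr.pow _).div_const _)
  · exact .of_forall fun θ => div_nonneg (pow_nonneg (hr0 θ θ.2) _) (Nat.cast_nonneg _)

/-- The embedding of `ℝᵈ` into `ℝᵈ⁺¹` as the hyperplane of vectors with vanishing first
coordinate. -/
def consZero (d : ℕ) : E d →ₗᵢ[ℝ] E (d + 1) where
  toFun x := WithLp.toLp 2 (Fin.cons 0 x)
  map_add' x y := by
    ext i
    refine Fin.cases ?_ (fun i => ?_) i <;> simp
  map_smul' c x := by
    ext i
    refine Fin.cases ?_ (fun i => ?_) i <;> simp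
  norm_map' x := by simp [EuclideanSpace.norm_eq, Fin.sum_univ_succ]

/-- The first vector of the standard basis of `ℝᵈ⁺¹`. -/
def firstVec (d : ℕ) : E (d + 1) := EuclideanSpace.single 0 1

theorem norm_firstVec (d : ℕ) : ‖firstVec d‖ = 1 := by simp [firstVec]

theorem inner_firstVec {d : ℕ} (x : E (d + 1)) : ⟪x, firstVec d⟫ = x 0 := by
  simp [firstVec, EuclideanSpace.inner_single_right]

theorem range_consZero (d : ℕ) : Set.range (consZero d) = hyperplane (firstVec d) := by
  ext x
  simp only [Set.mem_range, hyperplane, Set.mem_ofPred_eq, inner_firstVec]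
  constructor
  · rintro ⟨y, rfl⟩
    rfl
  · intro h
    refine ⟨WithLp.toLp 2 fun i => x i.succ, ?_⟩
    ext i
    refine Fin.cases ?_ (fun i => ?_) i
    · exact h.symm
    · rfl

theorem exists_inner_consZero {d : ℕ} (w : E (d + 1)) :
    ∃ a : E d, (∀ θ, ⟪consZero d θ, w⟫ = ⟪θ, a⟫) ∧ ‖a‖ ^ 2 = ‖w‖ ^ 2 - ⟪w, firstVec d⟫ ^ 2 := by
  refine ⟨WithLp.toLp 2 fun i => w i.succ, fun θ => ?_, ?_⟩
  · simp [consZero, PiLp.inner_apply, Fin.sum_univ_succ]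
  · simp [inner_firstVec, EuclideanSpace.norm_sq_eq, Fin.sum_univ_succ]

theorem norm_consZero_sphere {d : ℕ} (θ : sphere (0 : E d) 1) : ‖consZero d θ‖ = 1 :=
  ((consZero d).norm_map _).trans (norm_eq_of_mem_sphere θ)

/-- Functions in the kernel of the spherical Radon transform, averaged against the powers of
`‖v‖ ^ 2 - ⟪v, ·⟫ ^ 2`. -/
theorem integral_mul_orthogonal_pow_eq_zero {d : ℕ} {G : Type*}
    [TopologicalSpace G] [CompactSpace G] [MeasurableSpace G] [BorelSpace G]
    {μ : Measure G} [IsFiniteMeasure μ]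
    {rot : G → E (d + 1) ≃ₗᵢ[ℝ] E (d + 1)} (h : IsRotationAverage μ rot)
    (hd : d ≠ 0) {F : E (d + 1) → ℝ} (hF : Continuous F)
    (hzero : ∀ T : E (d + 1) ≃ₗᵢ[ℝ] E (d + 1), ∫ θ : sphere (0 : E d) 1, F (T (consZero d θ))
      ∂(volume : Measure (E d)).toSphere = 0) (v : E (d + 1)) (k : ℕ) :
    ∫ g : G, F (rot g (firstVec d)) * (‖v‖ ^ 2 - ⟪v, rot g (firstVec d)⟫ ^ 2) ^ k
      ∂μ = 0 := by
  obtain ⟨c, hc, hmom⟩ := exists_sphere_moment hd k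
  have hrot : Continuous fun p : G × sphere (0 : E d) 1 =>
      rot p.1 (consZero d p.2) :=
    h.continuous_rot.comp (continuous_fst.prodMk
      ((consZero d).continuous.comp (continuous_subtype_val.comp continuous_snd)))
  have hrote : Continuous fun p : G × sphere (0 : E d) 1 =>
      rot p.1 (firstVec d) := (h.continuous_rot_apply _).comp continuous_fst
  have h1 : ∀ g : G,
      ∫ θ : sphere (0 : E d) 1, F (rot g (firstVec d)) * ⟪rot g (consZero d θ), v⟫ ^ (2 * k)
        ∂(volume : Measure (E d)).toSphere =
      c * (F (rot g (firstVec d)) * (‖v‖ ^ 2 - ⟪v, rot g (firstVec d)⟫ ^ 2) ^ k) := by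
    intro g
    obtain ⟨a, ha, hnorm⟩ := exists_inner_consZero ((rot g).symm v)
    have hadj : ∀ x, ⟪rot g x, v⟫ = ⟪x, (rot g).symm v⟫ := fun x => by
      rw [← LinearIsometryEquiv.inner_map_map (rot g) x, LinearIsometryEquiv.apply_symm_apply]
    simp only [hadj, ha]
    rw [integral_const_mul, hmom a, hnorm, real_inner_comm, ← hadj, real_inner_comm,
      LinearIsometryEquiv.norm_map]
    ring
  have h2 : ∫ g : G, ∫ θ : sphere (0 : E d) 1,
      F (rot g (firstVec d)) * ⟪rot g (consZero d θ), v⟫ ^ (2 * k)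
        ∂(volume : Measure (E d)).toSphere ∂μ = 0 := by
    rw [integral_integral_swap_of_hasCompactSupport
      (((hF.comp hrote).mul ((hrot.inner continuous_const).pow _)) :) (.of_compactSpace _)]
    have h3 : ∀ θ : sphere (0 : E d) 1,
        ∫ g : G, F (rot g (firstVec d)) * ⟪rot g (consZero d θ), v⟫ ^ (2 * k) ∂μ =
        ∫ g : G, F (rot g (consZero d θ)) * ⟪rot g (firstVec d), v⟫ ^ (2 * k) ∂μ := by
      intro θ
      obtain ⟨T, hT, hT'⟩ := exists_linearIsometryEquiv_eq
        ((norm_firstVec d).trans (norm_consZero_sphere θ).symm)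
      have := h.integral_rot_comp T (fun x y => F x * ⟪y, v⟫ ^ (2 * k)) (consZero d θ) (firstVec d)
      rwa [hT, hT'] at this
    simp only [h3]
    rw [← integral_integral_swap_of_hasCompactSupport
      (((hF.comp hrot).mul ((hrote.inner continuous_const).pow _)) :) (.of_compactSpace _)]
    simp [integral_mul_const, hzero]
  simp only [h1] at h2
  rw [integral_const_mul] at h2
  exact (mul_eq_zero.1 h2).resolve_left hc.ne'

theorem integral_mul_inner_pow_even_eq_zero {d : ℕ} {G : Type*}
    [TopologicalSpace G] [CompactSpace G] [MeasurableSpace G] [BorelSpace G]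
    {μ : Measure G} [IsFiniteMeasure μ]
    {rot : G → E (d + 1) ≃ₗᵢ[ℝ] E (d + 1)} (h : IsRotationAverage μ rot)
    (hd : d ≠ 0) {F : E (d + 1) → ℝ} (hF : Continuous F)
    (hzero : ∀ T : E (d + 1) ≃ₗᵢ[ℝ] E (d + 1), ∫ θ : sphere (0 : E d) 1, F (T (consZero d θ))
      ∂(volume : Measure (E d)).toSphere = 0) (v : E (d + 1)) (k : ℕ) :
    ∫ g : G, F (rot g (firstVec d)) * (⟪v, rot g (firstVec d)⟫ ^ 2) ^ k ∂μ = 0 := by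
  have hcont := h.continuous_rot_apply (firstVec d)
  have hexp : ∀ g, F (rot g (firstVec d)) * (⟪v, rot g (firstVec d)⟫ ^ 2) ^ k =
      ∑ m ∈ Finset.range (k + 1), F (rot g (firstVec d)) *
        (‖v‖ ^ 2 - ⟪v, rot g (firstVec d)⟫ ^ 2) ^ m *
        ((-1) ^ m * (‖v‖ ^ 2) ^ (k - m) * k.choose m) := by
    intro g
    have : ⟪v, rot g (firstVec d)⟫ ^ 2 =
      (-1) * (‖v‖ ^ 2 - ⟪v, rot g (firstVec d)⟫ ^ 2) + ‖v‖ ^ 2 := by ring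
    conv_lhs => rw [this, add_pow, Finset.mul_sum]
    refine Finset.sum_congr rfl fun m _ => ?_
    rw [mul_pow]
    ring
  simp only [hexp]
  rw [integral_finsetSum]
  · refine Finset.sum_eq_zero fun m _ => ?_
    rw [integral_mul_const, integral_mul_orthogonal_pow_eq_zero h hd hF hzero, zero_mul]
  · intro m _
    refine integrable_of_compactSpace ?_
    fun_prop

/-- Injectivity of the spherical Radon transform on even continuous functions. -/
theorem eq_zero_of_sphere_section_integral_eq_zero {d : ℕ} (hd : d ≠ 0) {F : E (d + 1) → ℝ}
    (hF : Continuous F) (heven : ∀ u ∈ sphere (0 : E (d + 1)) 1, F (-u) = F u)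
    (hzero : ∀ T : E (d + 1) ≃ₗᵢ[ℝ] E (d + 1), ∫ θ : sphere (0 : E d) 1, F (T (consZero d θ))
      ∂(volume : Measure (E d)).toSphere = 0) {u : E (d + 1)} (hu : ‖u‖ = 1) : F u = 0 := by
  obtain ⟨G, _, _, _, _, μ, _, _, rot, h⟩ := exists_isRotationAverage (E (d + 1))
  obtain ⟨g, rfl⟩ := h.exists_rot_eq ((norm_firstVec d).trans hu.symm)
  have hcont := h.continuous_rot_apply (firstVec d)
  refine eq_zero_of_integral_mul_exp (μ := μ) hcont hF (fun v => ?_) g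
  refine integral_mul_exp_eq_zero (by fun_prop) (by fun_prop) fun k => ?_
  obtain ⟨m, rfl | rfl⟩ := k.even_or_odd'
  · simp only [pow_mul]
    exact integral_mul_inner_pow_even_eq_zero h hd hF hzero v m
  · have h := h.integral_rot_comp (LinearIsometryEquiv.neg ℝ)
      (fun x _ => F x * ⟪v, x⟫ ^ (2 * m + 1)) (firstVec d) (firstVec d)
    have hev : ∀ g : G, F (-rot g (firstVec d)) = F (rot g (firstVec d)) :=
      fun g => heven _ (by simp [norm_firstVec])
    simp only [LinearIsometryEquiv.coe_neg, map_neg, inner_neg_right, hev,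
      (odd_two_mul_add_one m).neg_pow, mul_neg, integral_neg] at h
    linarith

theorem radialFn_nonneg {n : ℕ} (M : Set (E n)) (x : E n) : 0 ≤ radialFn M x :=
  Real.sSup_nonneg fun _ hc => hc.1

theorem IsStarBody.smul_mem_iff {n : ℕ} {M : Set (E n)} (hM : IsStarBody M) {θ : E n}
    (hθ : θ ∈ sphere (0 : E n) 1) {t : ℝ} (ht : 0 < t) : t • θ ∈ M ↔ t ≤ radialFn M θ := by
  obtain ⟨hcomp, h0, hstar, -⟩ := hM
  have hθ1 : ‖θ‖ = 1 := by simpa using hθ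
  have hclosed : IsClosed {c : ℝ | 0 ≤ c ∧ c • θ ∈ M} :=
    (isClosed_le continuous_const continuous_id).inter
      (hcomp.isClosed.preimage (by fun_prop : Continuous fun c : ℝ => c • θ))
  have hbdd : BddAbove {c : ℝ | 0 ≤ c ∧ c • θ ∈ M} := by
    obtain ⟨R, hR⟩ := hcomp.isBounded.exists_norm_le
    refine ⟨R, fun c hc => ?_⟩
    simpa [norm_smul, hθ1, abs_of_nonneg hc.1] using hR _ hc.2
  have hne : {c : ℝ | 0 ≤ c ∧ c • θ ∈ M}.Nonempty := ⟨0, le_rfl, by simpa using h0⟩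
  refine ⟨fun h => le_csSup hbdd ⟨ht.le, h⟩, fun h => ?_⟩
  have hmem := (hclosed.csSup_mem hne hbdd).2
  change radialFn M θ • θ ∈ M at hmem
  have hpos := ht.trans_le h
  have := hstar.smul_mem hmem (div_nonneg ht.le hpos.le) ((div_le_one hpos).2 h)
  rwa [smul_smul, div_mul_cancel₀ _ hpos.ne'] at this

theorem IsStarBody.eq_of_radialFn_eq {n : ℕ} {M₁ M₂ : Set (E n)} (hM₁ : IsStarBody M₁)
    (hM₂ : IsStarBody M₂) (h : ∀ θ ∈ sphere (0 : E n) 1, radialFn M₁ θ = radialFn M₂ θ) :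
    M₁ = M₂ := by
  ext x
  rcases eq_or_ne x 0 with rfl | hx
  · exact iff_of_true hM₁.2.1 hM₂.2.1
  · have hx' := norm_pos_iff.2 hx
    have hθ : ‖x‖⁻¹ • x ∈ sphere (0 : E n) 1 := by simp [norm_smul, hx'.ne']
    rw [← smul_inv_smul₀ hx'.ne' x, hM₁.smul_mem_iff hθ hx', hM₂.smul_mem_iff hθ hx', h _ hθ]

theorem IsCentered.radialFn_neg {n : ℕ} {M : Set (E n)} (hM : IsCentered M) (x : E n) :
    radialFn M (-x) = radialFn M x := by
  simp only [radialFn, smul_neg, ← hM _]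

/-- The Hausdorff measure of a central section in terms of the radial function. -/
theorem exists_hausdorffMeasure_section_eq {d : ℕ} (hd : d ≠ 0) :
    ∃ c : ℝ≥0∞, c ≠ 0 ∧ c ≠ ∞ ∧ ∀ M : Set (E (d + 1)), IsStarBody M →
      ∀ j : E d →ₗᵢ[ℝ] E (d + 1), ∀ u, Set.range j = hyperplane u →
      μH[(d : ℝ)] (M ∩ hyperplane u) = c * ENNReal.ofReal
        ((∫ θ : sphere (0 : E d) 1, radialFn M (j θ) ^ d
          ∂(volume : Measure (E d)).toSphere) / d) := by
  have hH : (μH[(d : ℝ)] : Measure (E d)).IsAddHaarMeasure := by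
    simpa using isAddHaarMeasure_hausdorffMeasure (E := E d)
  refine ⟨(μH[(d : ℝ)] : Measure (E d)).addHaarScalarFactor volume, ?_, ENNReal.coe_ne_top,
    fun M hM j u hj => ?_⟩
  · exact ENNReal.coe_ne_zero.2 (Measure.addHaarScalarFactor_pos_of_isAddHaarMeasure _ _).ne'
  · rw [← hj, ← Set.image_preimage_eq_inter_range,
      j.isometry.hausdorffMeasure_image (.inl (Nat.cast_nonneg d))]
    have hsmul := congrArg (fun ν : Measure (E d) => ν (j ⁻¹' M))
      (Measure.isAddLeftInvariant_eq_smul (μH[(d : ℝ)] : Measure (E d)) volume)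
    refine hsmul.trans ?_
    have hsph : ∀ θ ∈ sphere (0 : E d) 1, j θ ∈ sphere (0 : E (d + 1)) 1 := by simp
    have hcont : Continuous fun θ : sphere (0 : E d) 1 => radialFn M (j θ) :=
      hM.2.2.2.comp_continuous (j.continuous.comp continuous_subtype_val) fun θ => hsph θ θ.2
    rw [Measure.smul_apply, volume_eq_of_radial hd hcont (fun _ _ => radialFn_nonneg _ _)
      fun θ hθ t ht => ?_]
    · rfl
    · rw [Set.mem_preimage, map_smul, hM.smul_mem_iff (hsph θ hθ) ht]

theorem hyperplane_map {n : ℕ} (T : E n ≃ₗᵢ[ℝ] E n) (u : E n) :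
    hyperplane (T u) = T '' hyperplane u := by
  ext x
  obtain ⟨x, rfl⟩ := T.surjective x
  simp [hyperplane, T.injective.mem_set_image]

/-- Two centered star bodies with the same central section areas in every
direction coincide; equivalently the centered star body `M` with `L = IM` is
unique. -/
theorem centered_star_body_unique_sections (n : ℕ) (hn : 2 ≤ n) (M₁ M₂ : Set (E n))
    (hM₁ : IsStarBody M₁) (hc₁ : IsCentered M₁)
    (hM₂ : IsStarBody M₂) (hc₂ : IsCentered M₂)
    (hsec : ∀ u ∈ sphere (0 : E n) 1,
      μH[(n : ℝ) - 1] (M₁ ∩ hyperplane u) = μH[(n : ℝ) - 1] (M₂ ∩ hyperplane u)) :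
    M₁ = M₂ := by
  obtain ⟨d, rfl⟩ : ∃ d, n = d + 1 := ⟨n - 1, by lia⟩
  have hd : d ≠ 0 := by lia
  simp only [Nat.cast_add, Nat.cast_one, add_sub_cancel_right] at hsec
  obtain ⟨c, hc0, hctop, hc⟩ := exists_hausdorffMeasure_section_eq hd
  have hcont : ∀ M : Set (E (d + 1)), IsStarBody M →
      Continuous fun u : sphere (0 : E (d + 1)) 1 => radialFn M u := fun M hM =>
    hM.2.2.2.comp_continuous continuous_subtype_val fun u => u.2
  obtain ⟨F, hF⟩ := ContinuousMap.exists_restrict_eq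
    (isClosed_sphere (x := (0 : E (d + 1))) (ε := 1))
    ⟨fun u : sphere (0 : E (d + 1)) 1 => radialFn M₁ u ^ d - radialFn M₂ u ^ d,
      ((hcont M₁ hM₁).pow d).sub ((hcont M₂ hM₂).pow d)⟩
  have hFs : ∀ u ∈ sphere (0 : E (d + 1)) 1, F u = radialFn M₁ u ^ d - radialFn M₂ u ^ d :=
    fun u hu => congrArg (fun f => f ⟨u, hu⟩) hF
  refine hM₁.eq_of_radialFn_eq hM₂ fun u hu => ?_
  rw [← pow_left_inj₀ (radialFn_nonneg _ _) (radialFn_nonneg _ _) hd, ← sub_eq_zero, ← hFs u hu]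
  refine eq_zero_of_sphere_section_integral_eq_zero hd F.continuous (fun w hw => ?_) (fun T => ?_)
    (by simpa using hu)
  · rw [hFs w hw, hFs (-w) (by simpa using hw), hc₁.radialFn_neg, hc₂.radialFn_neg]
  · let j : E d →ₗᵢ[ℝ] E (d + 1) := T.toLinearIsometry.comp (consZero d)
    have hj : Set.range j = hyperplane (T (firstVec d)) := by
      rw [hyperplane_map, ← range_consZero, ← Set.range_comp]
      rfl
    have hsph : ∀ θ : sphere (0 : E d) 1, j θ ∈ sphere (0 : E (d + 1)) 1 := by simp
    have hint : ∀ M : Set (E (d + 1)), IsStarBody M →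
        Integrable (fun θ : sphere (0 : E d) 1 => radialFn M (j θ) ^ d)
          (volume : Measure (E d)).toSphere := fun M hM =>
      integrable_of_compactSpace ((hM.2.2.2.comp_continuous
        (j.continuous.comp continuous_subtype_val) hsph).pow d)
    have hnonneg : ∀ M : Set (E (d + 1)), 0 ≤ (∫ θ : sphere (0 : E d) 1, radialFn M (j θ) ^ d
          ∂(volume : Measure (E d)).toSphere) / d := fun M =>
      div_nonneg (integral_nonneg fun θ => pow_nonneg (radialFn_nonneg _ _) _) (Nat.cast_nonneg d)
    have h := hsec (T (firstVec d)) (by simp [norm_firstVec])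
    rw [hc M₁ hM₁ j _ hj, hc M₂ hM₂ j _ hj, ENNReal.mul_right_inj hc0 hctop,
      ENNReal.ofReal_eq_ofReal_iff (hnonneg M₁) (hnonneg M₂),
      div_left_inj' (Nat.cast_ne_zero.2 hd)] at h
    calc ∫ θ : sphere (0 : E d) 1, F (j θ) ∂(volume : Measure (E d)).toSphere
        = ∫ θ : sphere (0 : E d) 1, (radialFn M₁ (j θ) ^ d - radialFn M₂ (j θ) ^ d)
          ∂(volume : Measure (E d)).toSphere := by
          congr 1 with θ
          exact hFs _ (hsph θ)
      _ = 0 := by rw [integral_sub (hint M₁ hM₁) (hint M₂ hM₂), h, sub_self]
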